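/- arXiv:1005.3456 — 4 statements merged into one kernel-verified Lean document; each statement's English description precedes it below -/
import Mathlib

section
/- Let A = (a_1, …, a_d) and B = (b_1, …, b_d) be two orthonormal bases of ℂ^d that are mutually unbiased, i.e. |⟨a_j, b_k⟩|² = 1/d for all j, k. Then for every unit vector ψ ∈ ℂ^d, the entropy excess X(A,B) = H(A) − R(B) is nonnegative: H(A) − R(B) ≥ 0, where H(A) = −∑_j p_j log p_j with p_j = |⟨a_j, ψ⟩|², and R(B) = ∑_k q_k log(d q_k) with q_k = |⟨b_k, ψ⟩|². -/
open scoped InnerProductSpace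

/-- Probability of outcome `j` when measuring the basis `A` on the state `ψ`. -/
noncomputable def measProb {d : ℕ}
    (A : OrthonormalBasis (Fin d) ℂ (EuclideanSpace ℂ (Fin d)))
    (ψ : EuclideanSpace ℂ (Fin d)) (j : Fin d) : ℝ :=
  ‖⟪A j, ψ⟫_ℂ‖ ^ 2

/-- Shannon entropy of the measurement distribution of basis `A` on state `ψ`
(natural logarithm, `0 · log 0 = 0`). -/
noncomputable def measEntropy {d : ℕ}
    (A : OrthonormalBasis (Fin d) ℂ (EuclideanSpace ℂ (Fin d)))
    (ψ : EuclideanSpace ℂ (Fin d)) : ℝ :=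
  -∑ j, measProb A ψ j * Real.log (measProb A ψ j)

/-- Entropic knowledge (relative entropy w.r.t. the uniform distribution) of the
measurement distribution of basis `A` on state `ψ`. -/
noncomputable def measKnowledge {d : ℕ}
    (A : OrthonormalBasis (Fin d) ℂ (EuclideanSpace ℂ (Fin d)))
    (ψ : EuclideanSpace ℂ (Fin d)) : ℝ :=
  ∑ j, measProb A ψ j * Real.log (d * measProb A ψ j)

section MaassenUffink

variable {ι κ E : Type*} [Fintype ι] [Fintype κ] [NormedAddCommGroup E] [InnerProductSpace ℂ E]

/-- The bilinear form of the transition matrix between two orthonormal bases is a contraction for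
the `ℓ²` norms. -/
lemma OrthonormalBasis.norm_sum_mul_inner_mul_le (A : OrthonormalBasis ι ℂ E)
    (B : OrthonormalBasis κ ℂ E) (u : ι → ℂ) (v : κ → ℂ) :
    ‖∑ j, ∑ k, u j * ⟪A j, B k⟫_ℂ * v k‖ ≤ √(∑ j, ‖u j‖ ^ 2) * √(∑ k, ‖v k‖ ^ 2) := by
  have h : ∑ j, ∑ k, u j * ⟪A j, B k⟫_ℂ * v k =
      ⟪A.repr.symm (WithLp.toLp 2 fun j => star (u j)), B.repr.symm (WithLp.toLp 2 v)⟫_ℂ := by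
    rw [← A.sum_repr_symm, ← B.sum_repr_symm, sum_inner]
    refine Finset.sum_congr rfl fun j _ => ?_
    rw [inner_sum]
    refine Finset.sum_congr rfl fun k _ => ?_
    simp [inner_smul_left, inner_smul_right]
    ring
  rw [h]
  refine (norm_inner_le_norm _ _).trans (le_of_eq ?_)
  simp [EuclideanSpace.norm_eq]

/-- The function interpolated by the three lines theorem in the proof of the entropic uncertainty
relation. -/
noncomputable def entropyInterp (A : OrthonormalBasis ι ℂ E) (B : OrthonormalBasis κ ℂ E) (ψ : E)
    (z : ℂ) : ℂ :=
  ∑ j, ∑ k, (⟪ψ, A j⟫_ℂ * Complex.exp (z * Real.log ‖⟪A j, ψ⟫_ℂ‖)) * ⟪A j, B k⟫_ℂ *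
    (⟪B k, ψ⟫_ℂ * Complex.exp (z * Real.log ‖⟪B k, ψ⟫_ℂ‖))

variable (A : OrthonormalBasis ι ℂ E) (B : OrthonormalBasis κ ℂ E) (ψ : E)

lemma norm_entropyInterp_le_one (hψ : ‖ψ‖ = 1) {z : ℂ} (hz : z.re = 0) :
    ‖entropyInterp A B ψ z‖ ≤ 1 := by
  refine (A.norm_sum_mul_inner_mul_le B _ _).trans (le_of_eq ?_)
  simp only [norm_mul, Complex.norm_exp, Complex.re_mul_ofReal, hz, zero_mul, Real.exp_zero,
    mul_one]
  rw [B.sum_sq_norm_inner_right, A.sum_sq_norm_inner_left, hψ]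
  simp

lemma norm_entropyInterp_le_of_norm_inner_le (hψ : ‖ψ‖ = 1) {c : ℝ}
    (hc : ∀ j k, ‖⟪A j, B k⟫_ℂ‖ ≤ c) {z : ℂ} (hz : z.re = 1) :
    ‖entropyInterp A B ψ z‖ ≤ c := by
  have key (w : ℂ) : ‖w‖ * Real.exp (Real.log ‖w‖) = ‖w‖ ^ 2 := by
    rcases eq_or_ne w 0 with rfl | hw
    · simp
    · rw [Real.exp_log (norm_pos_iff.2 hw), sq]
  calc ‖entropyInterp A B ψ z‖
      ≤ ∑ j, ∑ k, ‖⟪A j, ψ⟫_ℂ‖ ^ 2 * c * ‖⟪B k, ψ⟫_ℂ‖ ^ 2 := by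
        refine norm_sum_le_of_le _ fun j _ => norm_sum_le_of_le _ fun k _ => ?_
        simp only [norm_mul, Complex.norm_exp, Complex.re_mul_ofReal, hz, one_mul]
        rw [norm_inner_symm ψ, key, key]
        gcongr
        exact hc j k
    _ = c := by
        simp_rw [← Finset.mul_sum, ← Finset.sum_mul]
        rw [A.sum_sq_norm_inner_right, B.sum_sq_norm_inner_right, hψ]
        simp

lemma hasDerivAt_entropyInterp (z : ℂ) : HasDerivAt (entropyInterp A B ψ)
    (∑ j, ∑ k, (⟪ψ, A j⟫_ℂ * Complex.exp (z * Real.log ‖⟪A j, ψ⟫_ℂ‖)) * ⟪A j, B k⟫_ℂ *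
      (⟪B k, ψ⟫_ℂ * Complex.exp (z * Real.log ‖⟪B k, ψ⟫_ℂ‖)) *
      (Real.log ‖⟪A j, ψ⟫_ℂ‖ + Real.log ‖⟪B k, ψ⟫_ℂ‖)) z := by
  unfold entropyInterp
  refine HasDerivAt.fun_sum fun j _ => HasDerivAt.fun_sum fun k _ => ?_
  have h (a : ℂ) : HasDerivAt (fun z : ℂ => Complex.exp (z * a)) (Complex.exp (z * a) * a) z := by
    simpa using ((hasDerivAt_id z).mul_const a).cexp
  refine ((((h _).const_mul _).mul_const _).mul ((h _).const_mul _)).congr_deriv ?_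
  ring

lemma entropyInterp_zero (hψ : ‖ψ‖ = 1) : entropyInterp A B ψ 0 = 1 := by
  simp only [entropyInterp, zero_mul, Complex.exp_zero, mul_one, mul_assoc, ← Finset.mul_sum]
  simp [B.sum_inner_mul_inner, A.sum_inner_mul_inner, hψ, inner_self_eq_norm_sq_to_K]

lemma hasDerivAt_entropyInterp_zero : HasDerivAt (entropyInterp A B ψ)
    ((∑ j, ‖⟪A j, ψ⟫_ℂ‖ ^ 2 * Real.log ‖⟪A j, ψ⟫_ℂ‖ +
      ∑ k, ‖⟪B k, ψ⟫_ℂ‖ ^ 2 * Real.log ‖⟪B k, ψ⟫_ℂ‖ : ℝ) : ℂ) 0 := by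
  convert hasDerivAt_entropyInterp A B ψ 0 using 1
  simp only [zero_mul, Complex.exp_zero, mul_one, mul_add, Finset.sum_add_distrib]
  have hsq (w : E) (x : E) : ((‖⟪w, x⟫_ℂ‖ : ℂ)) ^ 2 = ⟪x, w⟫_ℂ * ⟪w, x⟫_ℂ := by
    rw [← inner_conj_symm x w, Complex.conj_mul']
  push_cast
  congr 1
  · refine Finset.sum_congr rfl fun j _ => ?_
    rw [← Finset.sum_mul, hsq]
    simp_rw [mul_assoc, ← Finset.mul_sum, ← mul_assoc]
    rw [B.sum_inner_mul_inner]
  · rw [Finset.sum_comm]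
    refine Finset.sum_congr rfl fun k _ => ?_
    simp_rw [← Finset.sum_mul]
    rw [A.sum_inner_mul_inner, hsq]

lemma norm_entropyInterp_le_rpow (hψ : ‖ψ‖ = 1) {c : ℝ}
    (hc : ∀ j k, ‖⟪A j, B k⟫_ℂ‖ ≤ c) {t : ℝ} (ht : t ∈ Set.Icc 0 1) :
    ‖entropyInterp A B ψ t‖ ≤ c ^ t := by
  have hd : Differentiable ℂ (entropyInterp A B ψ) :=
    fun z => (hasDerivAt_entropyInterp A B ψ z).differentiableAt
  have h := Complex.HadamardThreeLines.norm_le_interp_of_mem_verticalClosedStrip₀₁'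
    (entropyInterp A B ψ) (z := t) (a := 1) (b := c) ht
    hd.diffContOnCl ?_ (fun z hz => norm_entropyInterp_le_one A B ψ hψ hz)
    (fun z hz => norm_entropyInterp_le_of_norm_inner_le A B ψ hψ hc hz)
  · simpa using h
  · refine ⟨∑ j, ∑ k, (‖⟪A j, ψ⟫_ℂ‖ * Real.exp |Real.log ‖⟪A j, ψ⟫_ℂ‖|) * ‖⟪A j, B k⟫_ℂ‖ *
      (‖⟪B k, ψ⟫_ℂ‖ * Real.exp |Real.log ‖⟪B k, ψ⟫_ℂ‖|), ?_⟩
    rintro _ ⟨z, hz, rfl⟩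
    have hexp (a : ℝ) : z.re * a ≤ |a| := by
      have hz0 : 0 ≤ z.re := hz.1
      have hz1 : z.re ≤ 1 := hz.2
      calc z.re * a ≤ z.re * |a| := by gcongr; exact le_abs_self a
        _ ≤ 1 * |a| := by gcongr
        _ = |a| := one_mul _
    refine norm_sum_le_of_le _ fun j _ => norm_sum_le_of_le _ fun k _ => ?_
    simp only [norm_mul, Complex.norm_exp, Complex.re_mul_ofReal]
    rw [norm_inner_symm ψ]
    gcongr <;> exact hexp _

/-- The **Maassen–Uffink entropic uncertainty relation**. -/
theorem OrthonormalBasis.sum_mul_log_add_sum_mul_log_le (hψ : ‖ψ‖ = 1) {c : ℝ} (hc₀ : 0 < c)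
    (hc : ∀ j k, ‖⟪A j, B k⟫_ℂ‖ ≤ c) :
    ∑ j, ‖⟪A j, ψ⟫_ℂ‖ ^ 2 * Real.log ‖⟪A j, ψ⟫_ℂ‖ +
      ∑ k, ‖⟪B k, ψ⟫_ℂ‖ ^ 2 * Real.log ‖⟪B k, ψ⟫_ℂ‖ ≤ Real.log c := by
  set S := ∑ j, ‖⟪A j, ψ⟫_ℂ‖ ^ 2 * Real.log ‖⟪A j, ψ⟫_ℂ‖ +
    ∑ k, ‖⟪B k, ψ⟫_ℂ‖ ^ 2 * Real.log ‖⟪B k, ψ⟫_ℂ‖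
  have hf : HasDerivAt (fun t : ℝ => (entropyInterp A B ψ t).re) S 0 := by
    simpa only [Complex.ofReal_re] using
      HasDerivAt.real_of_complex (z := 0) (hasDerivAt_entropyInterp_zero A B ψ)
  have hg : HasDerivAt (fun t : ℝ => c ^ t) (Real.log c) 0 := by
    simpa using (Real.hasStrictDerivAt_const_rpow hc₀ 0).hasDerivAt
  have hlim := (hg.sub hf).tendsto_slope.mono_left
    (nhdsWithin_mono (0 : ℝ) (s := Set.Ioi 0) (t := {0}ᶜ) fun t ht => ne_of_gt ht)
  rw [← sub_nonneg]
  refine ge_of_tendsto hlim ?_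
  filter_upwards [Ioc_mem_nhdsGT (zero_lt_one' ℝ)] with t ht
  have hle : (entropyInterp A B ψ t).re ≤ c ^ t := (Complex.re_le_norm _).trans
    (norm_entropyInterp_le_rpow A B ψ hψ hc ⟨ht.1.le, ht.2⟩)
  have h0 := entropyInterp_zero A B ψ hψ
  simp only [slope_def_field, Pi.sub_apply, Complex.ofReal_zero, h0, Real.rpow_zero,
    Complex.one_re, sub_self, sub_zero]
  exact div_nonneg (sub_nonneg.2 hle) ht.1.le

end MaassenUffink

/-- For mutually unbiased orthonormal bases `A`, `B` of `ℂ^d` and any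
unit vector `ψ`, the entropy excess `X(A,B) = H(A) − R(B)` is nonnegative. -/
theorem entropy_excess_nonneg_of_mub (d : ℕ)
    (A B : OrthonormalBasis (Fin d) ℂ (EuclideanSpace ℂ (Fin d)))
    (hmub : ∀ j k, ‖⟪A j, B k⟫_ℂ‖ ^ 2 = 1 / d)
    (ψ : EuclideanSpace ℂ (Fin d)) (hψ : ‖ψ‖ = 1) :
    measEntropy A ψ - measKnowledge B ψ ≥ 0 := by
  rcases Nat.eq_zero_or_pos d with rfl | hd
  · simp [Subsingleton.elim ψ 0] at hψ
  have hd' : (0 : ℝ) < d := Nat.cast_pos.2 hd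
  have h := A.sum_mul_log_add_sum_mul_log_le B ψ hψ (c := √(1 / d)) (by positivity)
    fun j k => Real.le_sqrt_of_sq_le (hmub j k).le
  have hB : measKnowledge B ψ =
      Real.log d + 2 * ∑ k, ‖⟪B k, ψ⟫_ℂ‖ ^ 2 * Real.log ‖⟪B k, ψ⟫_ℂ‖ := by
    have hone : ∑ k, ‖⟪B k, ψ⟫_ℂ‖ ^ 2 = 1 := by rw [B.sum_sq_norm_inner_right, hψ, one_pow]
    rw [← one_mul (Real.log d), ← hone, Finset.sum_mul, Finset.mul_sum, ← Finset.sum_add_distrib]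
    refine Finset.sum_congr rfl fun k _ => ?_
    unfold measProb
    rcases eq_or_ne (‖⟪B k, ψ⟫_ℂ‖) 0 with h0 | h0
    · simp [h0]
    · rw [Real.log_mul hd'.ne' (pow_ne_zero 2 h0), Real.log_pow]
      push_cast
      ring
  have hA : measEntropy A ψ = -(2 * ∑ j, ‖⟪A j, ψ⟫_ℂ‖ ^ 2 * Real.log ‖⟪A j, ψ⟫_ℂ‖) := by
    rw [measEntropy, Finset.mul_sum]
    refine congrArg Neg.neg (Finset.sum_congr rfl fun j _ => ?_)
    rw [measProb, Real.log_pow]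
    push_cast
    ring
  rw [Real.log_sqrt (by positivity), one_div, Real.log_inv] at h
  rw [hA, hB]
  linarith
end

section
/- Let A = (a_1, …, a_d) and B = (b_1, …, b_d) be two orthonormal bases of ℂ^d that are mutually unbiased, i.e. |⟨a_j, b_k⟩|² = 1/d for all j, k. Then for every unit vector ψ ∈ ℂ^d, the measurement entropies satisfy H(A) + H(B) ≥ log d, where H(A) = −∑_j p_j log p_j with p_j = |⟨a_j, ψ⟩|² and H(B) = −∑_k q_k log q_k with q_k = |⟨b_k, ψ⟩|². -/
open scoped InnerProductSpace

section MaassenUffink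

variable {ι κ E : Type*} [Fintype ι] [Fintype κ] [NormedAddCommGroup E] [InnerProductSpace ℂ E]

/-- The analytic interpolation function in the proof of the Maassen–Uffink inequality. -/
noncomputable def overlapInterp (A : OrthonormalBasis ι ℂ E) (B : OrthonormalBasis κ ℂ E)
    (ψ : E) (z : ℂ) : ℂ :=
  ∑ j, ∑ k, ⟪ψ, B k⟫_ℂ * ⟪B k, A j⟫_ℂ * ⟪A j, ψ⟫_ℂ *
    Complex.exp (z * ((Real.log ‖⟪A j, ψ⟫_ℂ‖ + Real.log ‖⟪B k, ψ⟫_ℂ‖ : ℝ) : ℂ))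

theorem hasDerivAt_overlapInterp (A : OrthonormalBasis ι ℂ E) (B : OrthonormalBasis κ ℂ E)
    (ψ : E) (z : ℂ) :
    HasDerivAt (overlapInterp A B ψ)
      (∑ j, ∑ k, ⟪ψ, B k⟫_ℂ * ⟪B k, A j⟫_ℂ * ⟪A j, ψ⟫_ℂ *
        (Complex.exp (z * ((Real.log ‖⟪A j, ψ⟫_ℂ‖ + Real.log ‖⟪B k, ψ⟫_ℂ‖ : ℝ) : ℂ)) *
          ((Real.log ‖⟪A j, ψ⟫_ℂ‖ + Real.log ‖⟪B k, ψ⟫_ℂ‖ : ℝ) : ℂ))) z :=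
  HasDerivAt.fun_sum fun _ _ => HasDerivAt.fun_sum fun _ _ =>
    ((hasDerivAt_mul_const _).cexp).const_mul _

theorem inner_mul_inner_self_eq_sq_norm (x y : E) :
    ⟪x, y⟫_ℂ * ⟪y, x⟫_ℂ = ((‖⟪y, x⟫_ℂ‖ ^ 2 : ℝ) : ℂ) := by
  rw [← inner_conj_symm x y, mul_comm, Complex.mul_conj, Complex.normSq_eq_norm_sq]

theorem overlapInterp_zero (A : OrthonormalBasis ι ℂ E) (B : OrthonormalBasis κ ℂ E)
    {ψ : E} (hψ : ‖ψ‖ = 1) : overlapInterp A B ψ 0 = 1 := by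
  simp only [overlapInterp, zero_mul, Complex.exp_zero, mul_one, ← Finset.sum_mul]
  simp only [OrthonormalBasis.sum_inner_mul_inner]
  simp [inner_self_eq_norm_sq_to_K, hψ]

theorem hasDerivAt_overlapInterp_zero (A : OrthonormalBasis ι ℂ E) (B : OrthonormalBasis κ ℂ E)
    (ψ : E) :
    HasDerivAt (overlapInterp A B ψ)
      ((∑ j, ‖⟪A j, ψ⟫_ℂ‖ ^ 2 * Real.log ‖⟪A j, ψ⟫_ℂ‖ +
        ∑ k, ‖⟪B k, ψ⟫_ℂ‖ ^ 2 * Real.log ‖⟪B k, ψ⟫_ℂ‖ : ℝ) : ℂ) 0 := by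
  convert hasDerivAt_overlapInterp A B ψ 0 using 1
  simp only [zero_mul, Complex.exp_zero, one_mul]
  simp only [Complex.ofReal_add, mul_add, Finset.sum_add_distrib, Complex.ofReal_sum,
    Complex.ofReal_mul]
  congr 1
  · refine Finset.sum_congr rfl fun j _ => ?_
    rw [← Finset.sum_mul, ← Finset.sum_mul, OrthonormalBasis.sum_inner_mul_inner,
      inner_mul_inner_self_eq_sq_norm]
  · rw [Finset.sum_comm]
    refine Finset.sum_congr rfl fun k _ => ?_
    simp only [mul_assoc]
    rw [← Finset.mul_sum]
    simp only [← mul_assoc]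
    rw [← Finset.sum_mul, OrthonormalBasis.sum_inner_mul_inner, ← mul_assoc,
      inner_mul_inner_self_eq_sq_norm]

theorem norm_exp_mul_ofReal (z : ℂ) (x : ℝ) :
    ‖Complex.exp (z * (x : ℂ))‖ = Real.exp (z.re * x) := by
  rw [Complex.norm_exp, Complex.re_mul_ofReal]

theorem norm_overlapInterp_le_of_re_mem_Icc (A : OrthonormalBasis ι ℂ E)
    (B : OrthonormalBasis κ ℂ E) (ψ : E) {z : ℂ} (hz : z.re ∈ Set.Icc (0 : ℝ) 1) :
    ‖overlapInterp A B ψ z‖ ≤ ∑ j, ∑ k, ‖⟪ψ, B k⟫_ℂ * ⟪B k, A j⟫_ℂ * ⟪A j, ψ⟫_ℂ‖ *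
      Real.exp |Real.log ‖⟪A j, ψ⟫_ℂ‖ + Real.log ‖⟪B k, ψ⟫_ℂ‖| := by
  refine norm_sum_le_of_le _ fun j _ => norm_sum_le_of_le _ fun k _ => ?_
  rw [norm_mul, norm_exp_mul_ofReal]
  gcongr
  calc z.re * _ ≤ z.re * |_| := by gcongr; exacts [hz.1, le_abs_self _]
    _ ≤ _ := mul_le_of_le_one_left (abs_nonneg _) hz.2

theorem norm_sum_smul_orthonormalBasis_eq_one (A : OrthonormalBasis ι ℂ E) {ψ : E}
    (hψ : ‖ψ‖ = 1) {u : ι → ℂ} (hu : ∀ j, ‖u j‖ = 1) :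
    ‖∑ j, (u j * ⟪A j, ψ⟫_ℂ) • A j‖ = 1 := by
  rw [← sq_eq_sq₀ (norm_nonneg _) zero_le_one, ← A.sum_sq_norm_inner_right]
  simp only [A.orthonormal.inner_right_fintype, norm_mul, hu, one_mul]
  rw [A.sum_sq_norm_inner_right, hψ]

theorem norm_overlapInterp_le_one (A : OrthonormalBasis ι ℂ E) (B : OrthonormalBasis κ ℂ E)
    {ψ : E} (hψ : ‖ψ‖ = 1) {z : ℂ} (hz : z.re = 0) : ‖overlapInterp A B ψ z‖ ≤ 1 := by
  have hu (x : ℝ) (w : ℂ) (hw : w.re = 0) : ‖Complex.exp (w * (x : ℂ))‖ = 1 := by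
    rw [norm_exp_mul_ofReal, hw, zero_mul, Real.exp_zero]
  have key : overlapInterp A B ψ z =
      ⟪∑ k, (Complex.exp (starRingEnd ℂ z * (Real.log ‖⟪B k, ψ⟫_ℂ‖ : ℝ)) * ⟪B k, ψ⟫_ℂ) • B k,
        ∑ j, (Complex.exp (z * (Real.log ‖⟪A j, ψ⟫_ℂ‖ : ℝ)) * ⟪A j, ψ⟫_ℂ) • A j⟫_ℂ := by
    simp only [inner_sum, sum_inner, inner_smul_left, inner_smul_right, overlapInterp]
    refine Finset.sum_congr rfl fun j _ => ?_
    rw [Finset.mul_sum]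
    refine Finset.sum_congr rfl fun k _ => ?_
    simp only [map_mul, ← Complex.exp_conj, Complex.conj_conj, Complex.conj_ofReal,
      inner_conj_symm, Complex.ofReal_add, mul_add, Complex.exp_add]
    ring
  rw [key]
  refine (norm_inner_le_norm _ _).trans_eq ?_
  rw [norm_sum_smul_orthonormalBasis_eq_one A hψ fun j => hu _ z hz,
    norm_sum_smul_orthonormalBasis_eq_one B hψ fun k => hu _ _ (by simpa using hz), one_mul]

theorem norm_overlapInterp_le_of_re_eq_one (A : OrthonormalBasis ι ℂ E)
    (B : OrthonormalBasis κ ℂ E) {c : ℝ} (hAB : ∀ j k, ‖⟪A j, B k⟫_ℂ‖ ≤ c)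
    {ψ : E} (hψ : ‖ψ‖ = 1) {z : ℂ} (hz : z.re = 1) : ‖overlapInterp A B ψ z‖ ≤ c := by
  have hlog (x : ℝ) (hx : 0 ≤ x) : x * Real.exp (Real.log x) = x ^ 2 := by
    rcases hx.eq_or_lt with rfl | h
    · simp
    · rw [Real.exp_log h, sq]
  calc ‖overlapInterp A B ψ z‖
      ≤ ∑ j, ∑ k, c * (‖⟪A j, ψ⟫_ℂ‖ ^ 2 * ‖⟪B k, ψ⟫_ℂ‖ ^ 2) := by
        refine norm_sum_le_of_le _ fun j _ => norm_sum_le_of_le _ fun k _ => ?_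
        rw [norm_mul, norm_exp_mul_ofReal, hz, one_mul, Real.exp_add, norm_mul, norm_mul,
          ← hlog _ (norm_nonneg ⟪A j, ψ⟫_ℂ), ← hlog _ (norm_nonneg ⟪B k, ψ⟫_ℂ),
          norm_inner_symm ψ, norm_inner_symm (B k) (A j)]
        calc _ = ‖⟪A j, B k⟫_ℂ‖ * (‖⟪A j, ψ⟫_ℂ‖ * Real.exp (Real.log ‖⟪A j, ψ⟫_ℂ‖) *
              (‖⟪B k, ψ⟫_ℂ‖ * Real.exp (Real.log ‖⟪B k, ψ⟫_ℂ‖))) := by ring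
          _ ≤ _ := by gcongr; exact hAB j k
    _ = c := by
        simp only [← Finset.mul_sum, B.sum_sq_norm_inner_right, A.sum_sq_norm_inner_right, hψ,
          one_pow, mul_one]

theorem norm_overlapInterp_ofReal_le (A : OrthonormalBasis ι ℂ E) (B : OrthonormalBasis κ ℂ E)
    {c : ℝ} (hAB : ∀ j k, ‖⟪A j, B k⟫_ℂ‖ ≤ c) {ψ : E} (hψ : ‖ψ‖ = 1)
    {t : ℝ} (ht : t ∈ Set.Icc (0 : ℝ) 1) : ‖overlapInterp A B ψ t‖ ≤ c ^ t := by
  have h := Complex.HadamardThreeLines.norm_le_interp_of_mem_verticalClosedStrip₀₁'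
    (overlapInterp A B ψ) (z := t) (a := 1) (b := c)
    (by simpa [Complex.HadamardThreeLines.verticalClosedStrip] using ht)
    (Differentiable.diffContOnCl fun z => (hasDerivAt_overlapInterp A B ψ z).differentiableAt)
    ⟨_, by
      rintro _ ⟨z, hz, rfl⟩
      exact norm_overlapInterp_le_of_re_mem_Icc A B ψ hz⟩
    (fun z hz => norm_overlapInterp_le_one A B hψ hz)
    (fun z hz => norm_overlapInterp_le_of_re_eq_one A B hAB hψ hz)
  simpa using h

/-- The **Maassen–Uffink inequality**, in terms of the moduli of the amplitudes. -/
theorem sum_sq_norm_inner_mul_log_add_le (A : OrthonormalBasis ι ℂ E)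
    (B : OrthonormalBasis κ ℂ E) {c : ℝ} (hc : 0 < c) (hAB : ∀ j k, ‖⟪A j, B k⟫_ℂ‖ ≤ c)
    {ψ : E} (hψ : ‖ψ‖ = 1) :
    ∑ j, ‖⟪A j, ψ⟫_ℂ‖ ^ 2 * Real.log ‖⟪A j, ψ⟫_ℂ‖ +
      ∑ k, ‖⟪B k, ψ⟫_ℂ‖ ^ 2 * Real.log ‖⟪B k, ψ⟫_ℂ‖ ≤ Real.log c := by
  have hF := HasDerivAt.real_of_complex (z := 0) (hasDerivAt_overlapInterp_zero A B ψ)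
  have hG : HasDerivAt (fun t : ℝ => c ^ t) (Real.log c) 0 := by
    simpa using Real.hasStrictDerivAt_const_rpow hc 0 |>.hasDerivAt
  have hslope := (hG.sub hF).tendsto_slope_zero_right
  rw [Complex.ofReal_re] at hslope
  refine sub_nonneg.1 (ge_of_tendsto hslope ?_)
  filter_upwards [Ioc_mem_nhdsGT (zero_lt_one' ℝ)] with t ht
  have hle := (Complex.re_le_norm _).trans
    (norm_overlapInterp_ofReal_le A B hAB hψ (Set.Ioc_subset_Icc_self ht))
  have h0 := overlapInterp_zero A B hψ
  simp only [Pi.sub_apply, zero_add, Real.rpow_zero, Complex.ofReal_zero, h0, Complex.one_re,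
    sub_self, sub_zero, smul_eq_mul]
  exact mul_nonneg (inv_nonneg.2 ht.1.le) (sub_nonneg.2 hle)

end MaassenUffink

theorem measEntropy_eq_neg_two_mul_sum {d : ℕ}
    (A : OrthonormalBasis (Fin d) ℂ (EuclideanSpace ℂ (Fin d)))
    (ψ : EuclideanSpace ℂ (Fin d)) :
    measEntropy A ψ = -(2 * ∑ j, ‖⟪A j, ψ⟫_ℂ‖ ^ 2 * Real.log ‖⟪A j, ψ⟫_ℂ‖) := by
  simp only [measEntropy, measProb, Real.log_pow, Finset.mul_sum, Nat.cast_ofNat,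
    mul_left_comm (2 : ℝ)]

/-- (Entropic uncertainty relation for MUBs.) For mutually unbiased
orthonormal bases `A`, `B` of `ℂ^d` and any unit vector `ψ`,
`H(A) + H(B) ≥ log d`. -/
theorem entropy_sum_ge_log_dim_of_mub (d : ℕ)
    (A B : OrthonormalBasis (Fin d) ℂ (EuclideanSpace ℂ (Fin d)))
    (hmub : ∀ j k, ‖⟪A j, B k⟫_ℂ‖ ^ 2 = 1 / d)
    (ψ : EuclideanSpace ℂ (Fin d)) (hψ : ‖ψ‖ = 1) :
    measEntropy A ψ + measEntropy B ψ ≥ Real.log d := by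
  rcases Nat.eq_zero_or_pos d with rfl | hd
  · simp [measEntropy]
  have hd' : (0 : ℝ) < 1 / d := by positivity
  have h := sum_sq_norm_inner_mul_log_add_le A B (Real.sqrt_pos.2 hd')
    (fun j k => Real.le_sqrt_of_sq_le (hmub j k).le) hψ
  rw [Real.log_sqrt hd'.le, one_div, Real.log_inv] at h
  rw [measEntropy_eq_neg_two_mul_sum, measEntropy_eq_neg_two_mul_sum]
  linarith
end

section
/- Let ψ ∈ ℓ²(ℕ, ℂ) be the equal-superposition qubit state ψ_0 = ψ_1 = 1/√2 and ψ_m = 0 for m ≥ 2. Then the number distribution is p_0 = p_1 = 1/2, so H[m] = log 2; the canonical phase distribution is P(θ) = (1/2π)(1 + cos θ), and its phase knowledge equals R[φ] = ∫_0^{2π} P(θ) log(2π P(θ)) dθ = 1 − log 2, which is strictly less than log 2. Hence the entropy excess X[m, φ] = H[m] − R[φ] = 2 log 2 − 1 > 0 is strictly positive, i.e. such phase-localized states do not saturate the entropy-excess bound. -/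
open scoped Real

/-- Canonical phase distribution of a state `ψ = (ψ_m)` of the harmonic oscillator:
`P(θ) = (1/2π) |∑_m ψ_m e^{i m θ}|²`. -/
noncomputable def phaseDist (ψ : ℕ → ℂ) (θ : ℝ) : ℝ :=
  (1 / (2 * π)) * ‖∑' m : ℕ, ψ m * Complex.exp (Complex.I * (m : ℂ) * (θ : ℂ))‖ ^ 2

/-- Phase knowledge `R[φ] = ∫₀^{2π} P(θ) log (2π P(θ)) dθ`. -/
noncomputable def phaseKnowledge (ψ : ℕ → ℂ) : ℝ :=
  ∫ θ in (0 : ℝ)..(2 * π), phaseDist ψ θ * Real.log (2 * π * phaseDist ψ θ)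

theorem continuous_sin_sq_mul_log_sin :
    Continuous fun x => Real.sin x ^ 2 * Real.log (Real.sin x) := by
  have h : Continuous fun x => Real.sin x * Real.log (Real.sin x) :=
    Real.continuous_mul_log.comp Real.continuous_sin
  exact (Real.continuous_sin.mul h).congr fun x => by
    simp only [Pi.mul_apply]
    ring

/-- `∫₀^π sin² x log (sin x) dx = π/4 - (π/2) log 2`. -/
theorem integral_sin_sq_mul_log_sin :
    ∫ x in (0 : ℝ)..π, Real.sin x ^ 2 * Real.log (Real.sin x) = π / 4 - π / 2 * Real.log 2 := by
  have hlog : IntervalIntegrable (fun x => Real.log (Real.sin x)) MeasureTheory.volume 0 π :=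
    intervalIntegrable_log_sin
  have hcont : Continuous fun x => Real.sin x * Real.log (Real.sin x) :=
    Real.continuous_mul_log.comp Real.continuous_sin
  have hint : IntervalIntegrable (fun x => Real.sin x ^ 2 * Real.log (Real.sin x))
      MeasureTheory.volume 0 π := continuous_sin_sq_mul_log_sin.intervalIntegrable _ _
  have hderiv : ∀ x ∈ Set.Ioo (0 : ℝ) π,
      HasDerivAt (fun x => -(1 / 2) * (Real.cos x * (Real.sin x * Real.log (Real.sin x)))
        + (x + Real.sin x * Real.cos x) / 4)
        (Real.sin x ^ 2 * Real.log (Real.sin x) - 1 / 2 * Real.log (Real.sin x)) x := by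
    intro x hx
    have hs : Real.sin x ≠ 0 := (Real.sin_pos_of_mem_Ioo hx).ne'
    have hsin := Real.hasDerivAt_sin x
    have hcos := Real.hasDerivAt_cos x
    refine (((hcos.mul (hsin.mul (hsin.log hs))).const_mul (-(1 / 2))).add
      (((hasDerivAt_id x).add (hsin.mul hcos)).div_const 4)).congr_deriv ?_
    have hc : Real.cos x ^ 2 = 1 - Real.sin x ^ 2 := Real.cos_sq' x
    simp only [Pi.mul_apply]
    field_simp
    ring_nf
    rw [hc]
    ring
  have key := intervalIntegral.integral_eq_sub_of_hasDerivAt_of_le Real.pi_pos.le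
    (by fun_prop) hderiv (hint.sub (hlog.const_mul (1 / 2)))
  rw [intervalIntegral.integral_sub hint (hlog.const_mul (1 / 2)),
    intervalIntegral.integral_const_mul, integral_log_sin_zero_pi] at key
  simp only [Real.sin_pi, Real.sin_zero, zero_mul, mul_zero] at key
  linarith

/-- `∫₀^{2π} (1 + cos θ) log (1 + cos θ) dθ = 2π (1 - log 2)`. -/
theorem integral_one_add_cos_mul_log_one_add_cos :
    ∫ θ in (0 : ℝ)..(2 * π), (1 + Real.cos θ) * Real.log (1 + Real.cos θ) =
      2 * π * (1 - Real.log 2) := by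
  set g : ℝ → ℝ := fun θ => (1 + Real.cos θ) * Real.log (1 + Real.cos θ) with hg
  have hper : Function.Periodic g (2 * π) := fun θ => by simp [hg]
  have hshift : ∫ θ in (0 : ℝ)..(2 * π), g θ = ∫ θ in (0 : ℝ)..(2 * π), g (θ + π) := by
    rw [intervalIntegral.integral_comp_add_right, add_comm (2 * π) π, zero_add]
    simpa using hper.intervalIntegral_add_eq 0 π
  have hscale : ∫ θ in (0 : ℝ)..(2 * π), g (θ + π) = 2 * ∫ x in (0 : ℝ)..π, g (2 * x + π) := by
    rw [intervalIntegral.mul_integral_comp_mul_left (f := fun θ => g (θ + π)), mul_zero]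
  have hpoint : ∀ x, g (2 * x + π) = 2 * Real.log 2 * Real.sin x ^ 2
      + 4 * (Real.sin x ^ 2 * Real.log (Real.sin x)) := by
    intro x
    have h : 1 + Real.cos (2 * x + π) = 2 * Real.sin x ^ 2 := by
      rw [Real.cos_add_pi, Real.cos_two_mul, Real.cos_sq']
      ring
    simp only [hg, h]
    by_cases hs : Real.sin x = 0
    · simp [hs]
    · rw [Real.log_mul two_ne_zero (pow_ne_zero 2 hs), Real.log_pow]
      push_cast
      ring
  have hint : IntervalIntegrable (fun x => Real.sin x ^ 2 * Real.log (Real.sin x))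
      MeasureTheory.volume 0 π := continuous_sin_sq_mul_log_sin.intervalIntegrable _ _
  rw [hshift, hscale]
  simp_rw [hpoint]
  rw [intervalIntegral.integral_add (Continuous.intervalIntegrable (by fun_prop) _ _)
    (hint.const_mul 4), intervalIntegral.integral_const_mul, intervalIntegral.integral_const_mul,
    integral_sin_sq_mul_log_sin, integral_sin_sq]
  simp only [Real.sin_pi, Real.sin_zero, zero_mul]
  ring

/-- For the equal-superposition qubit state
`ψ₀ = ψ₁ = 1/√2`, `ψ_m = 0` for `m ≥ 2`: the number entropy is `H[m] = log 2`, the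
canonical phase distribution is `P(θ) = (1 + cos θ)/(2π)`, the phase knowledge is
`R[φ] = 1 − log 2 < log 2`, and the entropy excess `X[m,φ] = 2 log 2 − 1 > 0` is
strictly positive — such phase-localized states do not saturate the entropy-excess
bound. -/
theorem equal_superposition_entropy_excess (ψ : ℕ → ℂ)
    (h0 : ψ 0 = ((1 / Real.sqrt 2 : ℝ) : ℂ))
    (h1 : ψ 1 = ((1 / Real.sqrt 2 : ℝ) : ℂ))
    (h2 : ∀ m, 2 ≤ m → ψ m = 0) :
    (-∑' m, ‖ψ m‖ ^ 2 * Real.log (‖ψ m‖ ^ 2)) = Real.log 2 ∧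
      (∀ θ : ℝ, phaseDist ψ θ = (1 + Real.cos θ) / (2 * π)) ∧
      phaseKnowledge ψ = 1 - Real.log 2 ∧
      phaseKnowledge ψ < Real.log 2 ∧
      (-∑' m, ‖ψ m‖ ^ 2 * Real.log (‖ψ m‖ ^ 2)) - phaseKnowledge ψ =
        2 * Real.log 2 - 1 ∧
      0 < (-∑' m, ‖ψ m‖ ^ 2 * Real.log (‖ψ m‖ ^ 2)) - phaseKnowledge ψ := by
  have hnorm : ‖((1 / Real.sqrt 2 : ℝ) : ℂ)‖ ^ 2 = 1 / 2 := by
    rw [Complex.norm_real, Real.norm_eq_abs, sq_abs, div_pow, Real.sq_sqrt zero_le_two, one_pow]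
  have hH : (-∑' m, ‖ψ m‖ ^ 2 * Real.log (‖ψ m‖ ^ 2)) = Real.log 2 := by
    rw [tsum_eq_sum (s := Finset.range 2) fun m hm => by
      rw [h2 m (by simpa [Nat.succ_le_iff] using hm)]; simp]
    rw [Finset.sum_range_succ, Finset.sum_range_one, h0, h1, hnorm, one_div, Real.log_inv]
    ring
  have hP : ∀ θ : ℝ, phaseDist ψ θ = (1 + Real.cos θ) / (2 * π) := by
    intro θ
    have hsum : ∑' m : ℕ, ψ m * Complex.exp (Complex.I * (m : ℂ) * (θ : ℂ)) =
        ((1 / Real.sqrt 2 : ℝ) : ℂ) * (1 + Complex.exp (θ * Complex.I)) := by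
      rw [tsum_eq_sum (s := Finset.range 2) fun m hm => by
        rw [h2 m (by simpa [Nat.succ_le_iff] using hm), zero_mul]]
      rw [Finset.sum_range_succ, Finset.sum_range_one, h0, h1]
      simp only [Nat.cast_zero, Nat.cast_one, mul_zero, zero_mul, Complex.exp_zero, mul_one,
        mul_comm Complex.I (θ : ℂ)]
      ring
    have hexp : ‖1 + Complex.exp (θ * Complex.I)‖ ^ 2 = 2 * (1 + Real.cos θ) := by
      rw [← Complex.normSq_eq_norm_sq, Complex.normSq_apply, Complex.add_re, Complex.add_im,
        Complex.exp_ofReal_mul_I_re, Complex.exp_ofReal_mul_I_im, Complex.one_re, Complex.one_im]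
      linear_combination Real.sin_sq_add_cos_sq θ
    rw [phaseDist, hsum, norm_mul, mul_pow, hnorm, hexp]
    ring
  have hR : phaseKnowledge ψ = 1 - Real.log 2 := by
    have hpi : (2 * π) ≠ 0 := Real.two_pi_pos.ne'
    have hpoint : ∀ θ : ℝ, phaseDist ψ θ * Real.log (2 * π * phaseDist ψ θ) =
        (2 * π)⁻¹ * ((1 + Real.cos θ) * Real.log (1 + Real.cos θ)) := by
      intro θ
      rw [hP, mul_div_cancel₀ _ hpi]
      ring
    simp_rw [phaseKnowledge, hpoint]
    rw [intervalIntegral.integral_const_mul, integral_one_add_cos_mul_log_one_add_cos,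
      inv_mul_cancel_left₀ hpi]
  have hlog : 1 / 2 < Real.log 2 := by linarith [Real.log_two_gt_d9]
  rw [hH, hR]
  exact ⟨rfl, hP, rfl, by linarith, by ring, by linarith⟩
end

section
/- Fix d ∈ ℕ, d ≥ 1, and μ > 0. Suppose that for every unit vector ψ ∈ ℂ^d the pure-state inequality H[ψ] − μ R[ψ] ≥ 0 holds, where H[ψ] = −∑_{m=0}^{d−1} |ψ_m|² log |ψ_m|² and R[ψ] = ∫_0^{2π} P_ψ(θ) log(2π P_ψ(θ)) dθ with P_ψ(θ) = (1/2π) |∑_{m=0}^{d−1} ψ_m e^{i m θ}|². Then for every density matrix ρ on ℂ^d (positive semidefinite, trace 1), H[ρ] − μ R[ρ] ≥ 0, where H[ρ] = −∑_m ρ_{mm} log ρ_{mm} and R[ρ] = ∫_0^{2π} P_ρ(θ) log(2π P_ρ(θ)) dθ with P_ρ(θ) = (1/2π) ∑_{m,n} ρ_{mn} e^{i(n−m)θ}. -/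
open scoped Real ComplexOrder

/-- Number entropy of a pure state `ψ ∈ ℂ^d`: `H[ψ] = −∑_m |ψ_m|² log |ψ_m|²`. -/
noncomputable def numberEntropyPure {d : ℕ} (ψ : EuclideanSpace ℂ (Fin d)) : ℝ :=
  -∑ m, ‖ψ m‖ ^ 2 * Real.log (‖ψ m‖ ^ 2)

/-- Phase distribution of a pure state `ψ ∈ ℂ^d`:
`P_ψ(θ) = (1/2π) |∑_m ψ_m e^{i m θ}|²`. -/
noncomputable def phaseDistPure {d : ℕ} (ψ : EuclideanSpace ℂ (Fin d)) (θ : ℝ) : ℝ :=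
  (1 / (2 * π)) * ‖∑ m, ψ m * Complex.exp (Complex.I * ((m : ℕ) : ℂ) * (θ : ℂ))‖ ^ 2

/-- Phase knowledge of a pure state `ψ ∈ ℂ^d`. -/
noncomputable def phaseKnowledgePure {d : ℕ} (ψ : EuclideanSpace ℂ (Fin d)) : ℝ :=
  ∫ θ in (0 : ℝ)..(2 * π), phaseDistPure ψ θ * Real.log (2 * π * phaseDistPure ψ θ)

/-- Number entropy of a density matrix on `ℂ^d`: `H[ρ] = −∑_m ρ_{mm} log ρ_{mm}`. -/
noncomputable def numberEntropyM {d : ℕ} (ρ : Matrix (Fin d) (Fin d) ℂ) : ℝ :=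
  -∑ m, (ρ m m).re * Real.log ((ρ m m).re)

/-- Phase distribution of a density matrix on `ℂ^d`:
`P_ρ(θ) = (1/2π) ∑_{m,n} ρ_{mn} e^{i(n−m)θ}`. -/
noncomputable def phaseDistM {d : ℕ} (ρ : Matrix (Fin d) (Fin d) ℂ) (θ : ℝ) : ℝ :=
  (1 / (2 * π)) *
    (∑ m, ∑ n, ρ m n *
      Complex.exp (Complex.I * (((n : ℕ) : ℂ) - ((m : ℕ) : ℂ)) * (θ : ℂ))).re

/-- Phase knowledge of a density matrix on `ℂ^d`. -/
noncomputable def phaseKnowledgeM {d : ℕ} (ρ : Matrix (Fin d) (Fin d) ℂ) : ℝ :=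
  ∫ θ in (0 : ℝ)..(2 * π), phaseDistM ρ θ * Real.log (2 * π * phaseDistM ρ θ)

/-- Every density matrix is a convex combination of (conjugated) pure states. -/
theorem Matrix.PosSemidef.exists_convex_decomposition {d : ℕ} {ρ : Matrix (Fin d) (Fin d) ℂ}
    (hρ : ρ.PosSemidef) (htr : ρ.trace = 1) :
    ∃ (w : Fin d → ℝ) (ψ : Fin d → EuclideanSpace ℂ (Fin d)),
      (∀ k, 0 ≤ w k) ∧ ∑ k, w k = 1 ∧ (∀ k, ‖ψ k‖ = 1) ∧
      ∀ m n, ρ m n = ∑ k, (w k : ℂ) * (ψ k n * star (ψ k m)) := by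
  have hT := hρ.transpose
  refine ⟨hT.1.eigenvalues, hT.1.eigenvectorBasis, hT.eigenvalues_nonneg, ?_,
    hT.1.eigenvectorBasis.orthonormal.1, fun m n => ?_⟩
  · have h := hT.1.trace_eq_sum_eigenvalues
    rw [Matrix.trace_transpose, htr] at h
    simpa using (congrArg Complex.re h).symm
  · have h := congrFun (congrFun hT.1.spectral_theorem n) m
    rw [Matrix.transpose_apply] at h
    rw [h, Unitary.conjStarAlgAut_apply, Matrix.mul_apply]
    refine Finset.sum_congr rfl fun k _ => ?_
    simp [Matrix.mul_diagonal, Matrix.star_apply]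
    ring

section ConvexCombination

variable {d : ℕ} {ι : Type*} [Fintype ι] {ρ : Matrix (Fin d) (Fin d) ℂ} {w : ι → ℝ}
  {ψ : ι → EuclideanSpace ℂ (Fin d)}

theorem phaseDistPure_nonneg (φ : EuclideanSpace ℂ (Fin d)) (θ : ℝ) :
    0 ≤ phaseDistPure φ θ := by
  unfold phaseDistPure
  positivity

theorem continuous_phaseDistPure (φ : EuclideanSpace ℂ (Fin d)) :
    Continuous (phaseDistPure φ) := by
  unfold phaseDistPure
  fun_prop

theorem re_diag_eq_sum (hρ : ∀ m n, ρ m n = ∑ k, (w k : ℂ) * (ψ k n * star (ψ k m)))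
    (m : Fin d) : (ρ m m).re = ∑ k, w k * ‖ψ k m‖ ^ 2 := by
  rw [hρ, Complex.re_sum]
  refine Finset.sum_congr rfl fun k _ => ?_
  rw [Complex.re_ofReal_mul, Complex.star_def, Complex.mul_conj, Complex.ofReal_re,
    Complex.normSq_eq_norm_sq]

theorem phaseDistM_eq_sum (hρ : ∀ m n, ρ m n = ∑ k, (w k : ℂ) * (ψ k n * star (ψ k m)))
    (θ : ℝ) : phaseDistM ρ θ = ∑ k, w k * phaseDistPure (ψ k) θ := by
  have key : ∑ m, ∑ n, ρ m n *
      Complex.exp (Complex.I * (((n : ℕ) : ℂ) - ((m : ℕ) : ℂ)) * (θ : ℂ)) =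
      ∑ k, ((w k *
        ‖∑ m, ψ k m * Complex.exp (Complex.I * ((m : ℕ) : ℂ) * (θ : ℂ))‖ ^ 2 : ℝ) : ℂ) := by
    have hexp (m n : Fin d) :
        Complex.exp (Complex.I * (((n : ℕ) : ℂ) - ((m : ℕ) : ℂ)) * (θ : ℂ)) =
          Complex.exp (Complex.I * ((n : ℕ) : ℂ) * (θ : ℂ)) *
            star (Complex.exp (Complex.I * ((m : ℕ) : ℂ) * (θ : ℂ))) := by
      rw [Complex.star_def, ← Complex.exp_conj, ← Complex.exp_add]
      congr 1
      simp
      ring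
    have hpure (k : ι) :
        ((w k * ‖∑ m, ψ k m * Complex.exp (Complex.I * ((m : ℕ) : ℂ) * (θ : ℂ))‖ ^ 2 : ℝ) : ℂ) =
          ∑ m, ∑ n, (w k : ℂ) * (ψ k n * star (ψ k m)) *
            Complex.exp (Complex.I * (((n : ℕ) : ℂ) - ((m : ℕ) : ℂ)) * (θ : ℂ)) := by
      rw [← Complex.normSq_eq_norm_sq, Complex.ofReal_mul, ← Complex.mul_conj, map_sum,
        Finset.sum_mul_sum, Finset.sum_comm, Finset.mul_sum]
      refine Finset.sum_congr rfl fun m _ => ?_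
      rw [Finset.mul_sum]
      refine Finset.sum_congr rfl fun n _ => ?_
      rw [hexp, map_mul, Complex.star_def]
      ring
    simp_rw [hpure, hρ, Finset.sum_mul]
    exact (Finset.sum_congr rfl fun m _ => Finset.sum_comm).trans Finset.sum_comm
  rw [phaseDistM, key, ← Complex.ofReal_sum, Complex.ofReal_re, Finset.mul_sum]
  refine Finset.sum_congr rfl fun k _ => ?_
  rw [phaseDistPure]
  ring

/-- Concavity of the number entropy. -/
theorem sum_numberEntropyPure_le_numberEntropyM (hw : ∀ k, 0 ≤ w k) (hw1 : ∑ k, w k = 1)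
    (hρ : ∀ m n, ρ m n = ∑ k, (w k : ℂ) * (ψ k n * star (ψ k m))) :
    ∑ k, w k * numberEntropyPure (ψ k) ≤ numberEntropyM ρ := by
  simp only [numberEntropyPure, numberEntropyM, mul_neg, Finset.sum_neg_distrib, Finset.mul_sum]
  rw [Finset.sum_comm, neg_le_neg_iff]
  refine Finset.sum_le_sum fun m _ => ?_
  rw [re_diag_eq_sum hρ]
  exact Real.convexOn_mul_log.map_sum_le (p := fun k => ‖ψ k m‖ ^ 2) (fun k _ => hw k) hw1
    fun k _ => Set.mem_Ici.2 (sq_nonneg _)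

theorem continuous_mul_log_const_mul {f : ℝ → ℝ} (hf : Continuous f) {c : ℝ} (hc : c ≠ 0) :
    Continuous fun x => f x * Real.log (c * f x) := by
  have h := (Real.continuous_mul_log.comp (hf.const_mul c)).const_mul c⁻¹
  refine h.congr fun x => ?_
  simp [← mul_assoc, hc]

theorem convexOn_mul_log_const_mul {c : ℝ} (hc : 0 ≤ c) :
    ConvexOn ℝ (Set.Ici 0) fun x => x * Real.log (c * x) := by
  rcases hc.eq_or_lt with rfl | hc
  · simpa using convexOn_const (0 : ℝ) (convex_Ici (0 : ℝ))
  have h := Real.convexOn_mul_log.add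
    ((LinearMap.mulLeft ℝ (Real.log c)).convexOn (convex_Ici (0 : ℝ)))
  refine h.congr fun x _ => ?_
  rcases eq_or_ne x 0 with rfl | hx
  · simp
  · simp only [Pi.add_apply, LinearMap.mulLeft_apply, Real.log_mul hc.ne' hx]
    ring

/-- Convexity of the phase knowledge. -/
theorem phaseKnowledgeM_le_sum_phaseKnowledgePure (hw : ∀ k, 0 ≤ w k) (hw1 : ∑ k, w k = 1)
    (hρ : ∀ m n, ρ m n = ∑ k, (w k : ℂ) * (ψ k n * star (ψ k m))) :
    phaseKnowledgeM ρ ≤ ∑ k, w k * phaseKnowledgePure (ψ k) := by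
  have hpi : (0 : ℝ) < 2 * π := Real.two_pi_pos
  have hcont (k : ι) : Continuous fun θ =>
      w k * (phaseDistPure (ψ k) θ * Real.log (2 * π * phaseDistPure (ψ k) θ)) :=
    (continuous_mul_log_const_mul (continuous_phaseDistPure _) hpi.ne').const_mul _
  have hM : Continuous (phaseDistM ρ) := by
    rw [funext (phaseDistM_eq_sum hρ)]
    exact continuous_finsetSum _ fun k _ => (continuous_phaseDistPure _).const_mul _
  simp only [phaseKnowledgeM, phaseKnowledgePure, ← intervalIntegral.integral_const_mul]
  rw [← intervalIntegral.integral_finsetSum fun k _ => (hcont k).intervalIntegrable _ _]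
  refine intervalIntegral.integral_mono_on hpi.le
    ((continuous_mul_log_const_mul hM hpi.ne').intervalIntegrable _ _)
    ((continuous_finsetSum _ fun k _ => hcont k).intervalIntegrable _ _) fun θ _ => ?_
  rw [phaseDistM_eq_sum hρ]
  exact (convexOn_mul_log_const_mul hpi.le).map_sum_le (p := fun k => phaseDistPure (ψ k) θ)
    (fun k _ => hw k) hw1 fun k _ => phaseDistPure_nonneg _ _

end ConvexCombination

/-- Fix `d ≥ 1` and `μ > 0`. If the pure-state inequality
`H[ψ] − μ R[ψ] ≥ 0` holds for every unit vector `ψ ∈ ℂ^d`, then the mixed-state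
inequality `H[ρ] − μ R[ρ] ≥ 0` holds for every density matrix `ρ` on `ℂ^d`. -/
theorem entropy_excess_mu_mixed_of_pure (d : ℕ) (hd : 1 ≤ d) (μ : ℝ) (hμ : 0 < μ)
    (hpure : ∀ ψ : EuclideanSpace ℂ (Fin d), ‖ψ‖ = 1 →
      numberEntropyPure ψ - μ * phaseKnowledgePure ψ ≥ 0)
    (ρ : Matrix (Fin d) (Fin d) ℂ) (hρ : ρ.PosSemidef) (hρtr : ρ.trace = 1) :
    numberEntropyM ρ - μ * phaseKnowledgeM ρ ≥ 0 := by
  obtain ⟨w, ψ, hw, hw1, hψ, hdec⟩ := hρ.exists_convex_decomposition hρtr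
  have hH := sum_numberEntropyPure_le_numberEntropyM hw hw1 hdec
  have hR := mul_le_mul_of_nonneg_left
    (phaseKnowledgeM_le_sum_phaseKnowledgePure hw hw1 hdec) hμ.le
  have hsum : 0 ≤ ∑ k, w k * (numberEntropyPure (ψ k) - μ * phaseKnowledgePure (ψ k)) :=
    Finset.sum_nonneg fun k _ => mul_nonneg (hw k) (hpure (ψ k) (hψ k))
  simp only [mul_sub, Finset.sum_sub_distrib, mul_left_comm _ μ, ← Finset.mul_sum] at hsum
  linarith
end
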